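/- (Euler–Maclaurin estimate for Gaussian Riemann sums) Let 0 < a₁ ≤ a₂ be real numbers. There exists a constant C > 0 such that for every integer p ≥ 1, every a ∈ [a₁, a₂], and every v ∈ ℝ, one has | ∑_{m=0}^∞ exp(−2π (v − m/(a√p))²) − a√p · ∫_{−∞}^v exp(−2πt²) dt − (1/2) exp(−2πv²) | ≤ C · p^{−1/2}. -/

import Mathlib

open Real

open MeasureTheory Set Filter Topology

/-- The trapezoidal rule on a unit interval, with the error in integral form. -/
lemma abs_trapezoid_sub_integral_le {f f' f'' : ℝ → ℝ} (hf : ∀ x, HasDerivAt f (f' x) x)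
    (hf' : ∀ x, HasDerivAt f' (f'' x) x) (hc : Continuous f'') (n : ℝ) :
    |(f n + f (n + 1)) / 2 - ∫ x in n..(n + 1), f x| ≤ 1 / 8 * ∫ x in n..(n + 1), |f'' x| := by
  have hcf : Continuous f := continuous_iff_continuousAt.2 fun x => (hf x).continuousAt
  have hF (x : ℝ) : HasDerivAt
      (fun x => (x - n) * (1 - (x - n)) / 2 * f' x - (1 / 2 - (x - n)) * f x)
      ((x - n) * (1 - (x - n)) / 2 * f'' x + f x) x := by
    have h0 : HasDerivAt (fun x : ℝ => x - n) 1 x := (hasDerivAt_id x).sub_const n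
    refine ((((h0.mul (h0.const_sub 1)).div_const 2).mul (hf' x)).sub
      ((h0.const_sub (1 / 2)).mul (hf x))).congr_deriv ?_
    simp only [Pi.mul_apply]
    ring
  have hcg : Continuous fun x => (x - n) * (1 - (x - n)) / 2 * f'' x := by fun_prop
  have hFTC := intervalIntegral.integral_eq_sub_of_hasDerivAt (a := n) (b := n + 1)
    (fun x _ => hF x) ((hcg.add hcf).intervalIntegrable _ _)
  rw [intervalIntegral.integral_add (hcg.intervalIntegrable _ _)
    (hcf.intervalIntegrable _ _)] at hFTC
  have heq : (f n + f (n + 1)) / 2 - ∫ x in n..(n + 1), f x =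
      ∫ x in n..(n + 1), (x - n) * (1 - (x - n)) / 2 * f'' x := by
    have e : n + 1 - n = 1 := by ring
    rw [e] at hFTC
    linarith
  rw [heq, ← intervalIntegral.integral_const_mul]
  refine (intervalIntegral.abs_integral_le_integral_abs (by linarith)).trans ?_
  refine intervalIntegral.integral_mono_on (by linarith) (hcg.abs.intervalIntegrable _ _)
    ((continuous_const.mul hc.abs).intervalIntegrable _ _) fun x hx => ?_
  rw [abs_mul]
  gcongr
  rw [abs_le]
  constructor <;> nlinarith [hx.1, hx.2, sq_nonneg (x - n - 1 / 2)]

lemma abs_sum_range_sub_integral_le {f f' f'' : ℝ → ℝ} (hf : ∀ x, HasDerivAt f (f' x) x)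
    (hf' : ∀ x, HasDerivAt f' (f'' x) x) (hc : Continuous f'') (n : ℕ) :
    |∑ m ∈ Finset.range n, f m - (∫ x in (0 : ℝ)..n, f x) - f 0 / 2 + f n / 2| ≤
      1 / 8 * ∫ x in (0 : ℝ)..n, |f'' x| := by
  have hcf : Continuous f := continuous_iff_continuousAt.2 fun x => (hf x).continuousAt
  induction n with
  | zero => simp
  | succ n ih =>
    have h := abs_trapezoid_sub_integral_le hf hf' hc n
    rw [Finset.sum_range_succ]
    push_cast
    rw [← intervalIntegral.integral_add_adjacent_intervals (hcf.intervalIntegrable 0 (n : ℝ))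
        (hcf.intervalIntegrable (n : ℝ) (n + 1)),
      ← intervalIntegral.integral_add_adjacent_intervals (hc.abs.intervalIntegrable 0 (n : ℝ))
        (hc.abs.intervalIntegrable (n : ℝ) (n + 1))]
    rw [abs_le] at *
    constructor <;> linarith [h.1, h.2, ih.1, ih.2]

/-- The Euler–Maclaurin estimate on the half-line for a nonnegative `C²` function. -/
lemma abs_tsum_sub_integral_Ioi_le {f f' f'' : ℝ → ℝ} (hf : ∀ x, HasDerivAt f (f' x) x)
    (hf' : ∀ x, HasDerivAt f' (f'' x) x) (hc : Continuous f'') (h0 : ∀ x, 0 ≤ f x)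
    (hfi : IntegrableOn f (Ioi 0)) (hfi'' : IntegrableOn f'' (Ioi 0)) :
    |∑' m : ℕ, f m - (∫ x in Ioi 0, f x) - f 0 / 2| ≤ 1 / 8 * ∫ x in Ioi 0, |f'' x| := by
  have mono {g : ℝ → ℝ} (hg : IntegrableOn g (Ioi 0)) (hg0 : ∀ x, 0 ≤ g x) (n : ℕ) :
      ∫ x in (0 : ℝ)..n, g x ≤ ∫ x in Ioi 0, g x := by
    rw [intervalIntegral.integral_of_le n.cast_nonneg]
    exact setIntegral_mono_set hg (ae_of_all _ hg0) Ioc_subset_Ioi_self.eventuallyLE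
  have bound (n : ℕ) := (abs_sum_range_sub_integral_le hf hf' hc n).trans
    (mul_le_mul_of_nonneg_left (mono hfi''.abs (fun x => abs_nonneg _) n) (by norm_num))
  have hs : Summable fun m : ℕ => f m := by
    refine summable_of_sum_range_le (c := (∫ x in Ioi 0, f x) + f 0 / 2 +
      1 / 8 * ∫ x in Ioi 0, |f'' x|) (fun m => h0 m) fun n => ?_
    linarith [(abs_le.1 (bound n)).2, mono hfi h0 n, h0 n]
  have hlim := ((hs.hasSum.tendsto_sum_nat.sub (intervalIntegral_tendsto_integral_Ioi 0 hfi
    tendsto_natCast_atTop_atTop)).sub_const (f 0 / 2)).add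
    (hs.tendsto_atTop_zero.div_const 2)
  rw [zero_div, add_zero] at hlim
  exact le_of_tendsto hlim.abs (Eventually.of_forall bound)

lemma integral_Ioi_comp_sub_mul (g : ℝ → ℝ) (v : ℝ) {h : ℝ} (hh : 0 < h) :
    ∫ x in Ioi 0, g (v - x * h) = h⁻¹ * ∫ t in Iic v, g t := by
  have h1 := integral_comp_mul_right_Ioi (fun y => g (v - y)) 0 hh
  have h2 := (Measure.measurePreserving_sub_left volume v).setIntegral_preimage_emb
    (MeasurableEquiv.subLeft v).measurableEmbedding g (Iio v)
  have h3 : (fun x => v - x) ⁻¹' Iio v = Ioi 0 := by ext; simp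
  rw [h3] at h2
  rw [h1, zero_mul, h2, integral_Iic_eq_integral_Iio, smul_eq_mul]

lemma hasDerivAt_gaussian (x : ℝ) : HasDerivAt (fun x => rexp (-2 * π * x ^ 2))
    (-4 * π * x * rexp (-2 * π * x ^ 2)) x := by
  refine (((hasDerivAt_pow 2 x).const_mul (-2 * π)).exp).congr_deriv ?_
  norm_num
  ring

lemma hasDerivAt_deriv_gaussian (x : ℝ) :
    HasDerivAt (fun x => -4 * π * x * rexp (-2 * π * x ^ 2))
      ((16 * π ^ 2 * x ^ 2 - 4 * π) * rexp (-2 * π * x ^ 2)) x := by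
  refine (((hasDerivAt_id x).const_mul (-4 * π)).mul (hasDerivAt_gaussian x)).congr_deriv ?_
  simp only [id]
  ring

lemma integrable_gaussian : Integrable fun x : ℝ => rexp (-2 * π * x ^ 2) := by
  simpa using integrable_exp_neg_mul_sq (b := 2 * π) (by positivity)

lemma integrable_deriv_deriv_gaussian :
    Integrable fun x : ℝ => (16 * π ^ 2 * x ^ 2 - 4 * π) * rexp (-2 * π * x ^ 2) := by
  have h := integrable_rpow_mul_exp_neg_mul_sq (b := 2 * π) (by positivity) (s := 2) (by norm_num)
  simp only [rpow_two, ← neg_mul] at h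
  refine ((h.const_mul (16 * π ^ 2)).sub (integrable_gaussian.const_mul (4 * π))).congr
    (ae_of_all _ fun x => ?_)
  simp only [Pi.sub_apply]
  ring

/-- Euler–Maclaurin estimate for Gaussian Riemann sums, uniform in `v ∈ ℝ` and
`a ∈ [a₁, a₂] ⊂ (0, ∞)`. -/
theorem euler_maclaurin_gaussian_sum (a₁ a₂ : ℝ) (ha₁ : 0 < a₁) (ha : a₁ ≤ a₂) :
    ∃ C > 0, ∀ p : ℕ, 1 ≤ p → ∀ a ∈ Set.Icc a₁ a₂, ∀ v : ℝ,
      |(∑' m : ℕ, Real.exp (-2 * Real.pi * (v - m / (a * Real.sqrt p)) ^ 2)) -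
          a * Real.sqrt p * (∫ t in Set.Iic v, Real.exp (-2 * Real.pi * t ^ 2)) -
          (1 / 2) * Real.exp (-2 * Real.pi * v ^ 2)| ≤
        C * (p : ℝ) ^ (-(1 : ℝ) / 2) := by
  set g : ℝ → ℝ := fun x => rexp (-2 * π * x ^ 2) with hg
  set g' : ℝ → ℝ := fun x => -4 * π * x * rexp (-2 * π * x ^ 2)
  set g'' : ℝ → ℝ := fun x => (16 * π ^ 2 * x ^ 2 - 4 * π) * rexp (-2 * π * x ^ 2) with hg''
  have hgi'' : Integrable g'' := integrable_deriv_deriv_gaussian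
  have hI : 0 ≤ ∫ x, |g'' x| := integral_nonneg fun x => abs_nonneg _
  refine ⟨(1 / 8 * (∫ x, |g'' x|) + 1) / a₁, by positivity, fun p hp a hap v => ?_⟩
  have hp0 : (0 : ℝ) < p := by exact_mod_cast hp
  have ha0 : 0 < a := ha₁.trans_le hap.1
  have hsq : 0 < √(p : ℝ) := sqrt_pos.2 hp0
  set h : ℝ := (a * √p)⁻¹ with hh
  have hpos : 0 < h := by positivity
  have hl (x : ℝ) : HasDerivAt (fun x => v - x * h) (-h) x := by
    simpa using ((hasDerivAt_id x).mul_const h).const_sub v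
  have hint {k : ℝ → ℝ} (hk : Integrable k) : Integrable fun x => k (v - x * h) :=
    (hk.comp_sub_left v).comp_mul_right' hpos.ne'
  have key := abs_tsum_sub_integral_Ioi_le (f := fun x => g (v - x * h))
    (f' := fun x => -h * g' (v - x * h)) (f'' := fun x => h ^ 2 * g'' (v - x * h))
    (fun x => (HasDerivAt.comp (h₂ := g) x (hasDerivAt_gaussian _) (hl x)).congr_deriv
      (mul_comm _ _))
    (fun x => ((HasDerivAt.comp (h₂ := g') x (hasDerivAt_deriv_gaussian _) (hl x)).const_mul
      (-h)).congr_deriv (by simp only [hg'']; ring))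
    (by fun_prop) (fun x => (exp_pos _).le) (hint integrable_gaussian).integrableOn
    ((hint hgi'').const_mul _).integrableOn
  simp only [abs_mul, abs_of_nonneg (sq_nonneg h), integral_const_mul] at key
  rw [integral_Ioi_comp_sub_mul g v hpos, integral_Ioi_comp_sub_mul (fun x => |g'' x|) v hpos,
    hh, inv_inv, ← hh] at key
  have hle : ∫ t in Iic v, |g'' t| ≤ ∫ t, |g'' t| :=
    setIntegral_le_integral hgi''.abs (ae_of_all _ fun x => abs_nonneg _)
  have hrp : (p : ℝ) ^ (-(1 : ℝ) / 2) = (√p)⁻¹ := by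
    rw [neg_div, rpow_neg hp0.le, sqrt_eq_rpow]
  have hh1 : h ≤ a₁⁻¹ * (√p)⁻¹ := by
    rw [hh, mul_inv]
    gcongr
    exact hap.1
  calc _ = |∑' m : ℕ, g (v - m * h) - a * √p * (∫ t in Iic v, g t) - g (v - 0 * h) / 2| := by
        simp only [hg, hh, div_eq_mul_inv, zero_mul, sub_zero, one_mul, mul_comm (2 : ℝ)⁻¹]
    _ ≤ _ := key
    _ = h * (1 / 8 * ∫ t in Iic v, |g'' t|) := by
        rw [show a * √p = h⁻¹ by rw [hh, inv_inv]]
        field_simp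
    _ ≤ a₁⁻¹ * (√p)⁻¹ * (1 / 8 * (∫ t, |g'' t|) + 1) := by
        gcongr
        linarith
    _ = _ := by
        rw [hrp]
        ring
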